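/- For an odd prime N and u coprime to N, Σ_{n=0}^{N-1} exp(-iπ u n(n+1)/N) = ℓ_{2u} · η_N · √N · exp(2πi u ((N+1)/2)³ / N), where η_N = 1 if N ≡ 1 (mod 4) and η_N = −i if N ≡ 3 (mod 4), and ℓ_{2u} is the Legendre symbol of 2u modulo N. -/

import Mathlib

open Complex

/-- A theta function with real phase `r` and period `M` decomposes into residue classes mod `M`,
each of which is transformed by Poisson summation. -/
lemma jacobiTheta_add_eq_sum {M : ℕ} [NeZero M] {r : ℝ}
    (hr : ∀ (n : ℤ) (a : ℕ), exp (Real.pi * I * (n * M + a) ^ 2 * r) =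
      exp (Real.pi * I * a ^ 2 * r))
    {σ : ℂ} (hσ : 0 < σ.im) :
    jacobiTheta (r + σ) = 1 / (-I * (M ^ 2 * σ)) ^ (1 / 2 : ℂ) *
      ∑ a ∈ Finset.range M, exp (Real.pi * I * a ^ 2 * r) *
        jacobiTheta₂ (a / M : ℝ) (-1 / (M ^ 2 * σ)) := by
  have hM : (M : ℂ) ≠ 0 := NeZero.ne _
  have hσ0 : σ ≠ 0 := fun h ↦ by simp [h] at hσ
  have him : 0 < (M ^ 2 * σ).im := by
    have hM' : 0 < (M : ℝ) := by exact_mod_cast NeZero.pos M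
    have : (M ^ 2 * σ : ℂ).im = (M : ℝ) ^ 2 * σ.im := by
      rw [← im_ofReal_mul]; push_cast; rfl
    rw [this]; positivity
  have hrs : 0 < (r + σ).im := by simpa using hσ
  have hsum := hasSum_jacobiTheta₂_term 0 hrs
  rw [← jacobiTheta_eq_jacobiTheta₂] at hsum
  have hprod := (Int.divModEquiv M).symm.hasSum_iff.mpr hsum
  have hfib (a : Fin M) : HasSum (fun n : ℤ ↦ jacobiTheta₂_term (n * M + (a : ℕ)) 0 (r + σ))
      (exp (Real.pi * I * (a : ℕ) ^ 2 * r) * (1 / (-I * (M ^ 2 * σ)) ^ (1 / 2 : ℂ) *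
        jacobiTheta₂ ((a : ℕ) / M : ℝ) (-1 / (M ^ 2 * σ)))) := by
    have h := (hasSum_jacobiTheta₂_term ((a : ℕ) * M * σ) him).mul_left
      (exp (Real.pi * I * (a : ℕ) ^ 2 * r) * exp (Real.pi * I * (a : ℕ) ^ 2 * σ))
    have h1 : ((a : ℕ) * M * σ : ℂ) / (M ^ 2 * σ) = ((a : ℕ) / M : ℝ) := by
      push_cast
      field_simp
    have h2 : (-Real.pi * I * ((a : ℕ) * M * σ) ^ 2 / (M ^ 2 * σ) : ℂ) =
        -(Real.pi * I * (a : ℕ) ^ 2 * σ) := by field_simp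
    have h3 : exp (Real.pi * I * (a : ℕ) ^ 2 * σ) * exp (-(Real.pi * I * (a : ℕ) ^ 2 * σ)) = 1 := by
      rw [← Complex.exp_add, add_neg_cancel, Complex.exp_zero]
    rw [jacobiTheta₂_functional_equation ((a : ℕ) * M * σ), h1, h2] at h
    have hval : exp (Real.pi * I * (a : ℕ) ^ 2 * r) * exp (Real.pi * I * (a : ℕ) ^ 2 * σ) *
        (1 / (-I * (M ^ 2 * σ)) ^ (1 / 2 : ℂ) * exp (-(Real.pi * I * (a : ℕ) ^ 2 * σ)) *
          jacobiTheta₂ ((a : ℕ) / M : ℝ) (-1 / (M ^ 2 * σ))) =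
        exp (Real.pi * I * (a : ℕ) ^ 2 * r) * (1 / (-I * (M ^ 2 * σ)) ^ (1 / 2 : ℂ) *
          jacobiTheta₂ ((a : ℕ) / M : ℝ) (-1 / (M ^ 2 * σ))) := by
      linear_combination (exp (Real.pi * I * (a : ℕ) ^ 2 * r) *
        (1 / (-I * (M ^ 2 * σ)) ^ (1 / 2 : ℂ) *
          jacobiTheta₂ ((a : ℕ) / M : ℝ) (-1 / (M ^ 2 * σ)))) * h3
    rw [hval] at h
    have hterm (n : ℤ) : jacobiTheta₂_term (n * M + (a : ℕ)) 0 (r + σ) =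
        exp (Real.pi * I * (a : ℕ) ^ 2 * r) * exp (Real.pi * I * (a : ℕ) ^ 2 * σ) *
          jacobiTheta₂_term n ((a : ℕ) * M * σ) (M ^ 2 * σ) := by
      rw [← hr n a, jacobiTheta₂_term, jacobiTheta₂_term, ← Complex.exp_add, ← Complex.exp_add]
      push_cast
      congr 1
      ring
    simpa only [hterm] using h
  have hprod' := (Equiv.prodComm _ _).symm.hasSum_iff.mpr hprod
  have := (hprod'.prod_fiberwise (g := _) fun a ↦ by simpa [Function.comp_def] using hfib a).unique
    (hasSum_fintype _)
  rw [this, Finset.mul_sum, Finset.sum_range]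
  exact Finset.sum_congr rfl fun a _ ↦ by push_cast; ring_nf

/-- The two-variable theta function tends to `1` at `i∞`, for real first argument. -/
lemma tendsto_jacobiTheta₂_ofReal {ι : Type*} {l : Filter ι} {τ : ι → ℂ}
    (hτ : Filter.Tendsto (fun i ↦ (τ i).im) l Filter.atTop) (x : ℝ) :
    Filter.Tendsto (fun i ↦ jacobiTheta₂ x (τ i)) l (nhds 1) := by
  rw [← tsum_ite_eq (0 : ℤ) (fun _ ↦ (1 : ℂ))]
  refine tendsto_tsum_of_dominated_convergence
    (by simpa using summable_pow_mul_jacobiTheta₂_term_bound 0 one_pos 0) (fun n ↦ ?_) ?_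
  · rcases eq_or_ne n 0 with rfl | hn
    · simpa [jacobiTheta₂_term] using tendsto_const_nhds
    · rw [if_neg hn, tendsto_zero_iff_norm_tendsto_zero]
      simp only [norm_jacobiTheta₂_term, ofReal_im, mul_zero, sub_zero]
      refine Real.tendsto_exp_atBot.comp (hτ.const_mul_atTop_of_neg ?_)
      have : 0 < (n : ℝ) ^ 2 := by positivity
      nlinarith [Real.pi_pos]
  · filter_upwards [hτ.eventually_ge_atTop 1] with i hi n
    simpa using norm_jacobiTheta₂_term_le (S := 0) one_pos (z := x) (by simp) hi n

lemma ofReal_mul_cpow {t : ℝ} (ht : 0 < t) {z : ℂ} (hz : z ≠ 0) (s : ℂ) :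
    (t * z) ^ s = (t : ℂ) ^ s * z ^ s := by
  have ht' : (t : ℂ) ≠ 0 := ofReal_ne_zero.mpr ht.ne'
  rw [cpow_def_of_ne_zero (mul_ne_zero ht' hz), cpow_def_of_ne_zero ht', cpow_def_of_ne_zero hz,
    log_ofReal_mul ht hz, ← Complex.exp_add, ofReal_log ht.le, add_mul]

/-- The value of the quadratic Gauss sum. -/
theorem sum_exp_sq_div (N : ℕ) [NeZero N] :
    ∑ n ∈ Finset.range N, exp (2 * Real.pi * I * n ^ 2 / N) =
      (1 + I) / 2 * (1 + (-I) ^ N) * Real.sqrt N := by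
  have hN : 0 < (N : ℝ) := by exact_mod_cast NeZero.pos N
  have hN0 : (N : ℂ) ≠ 0 := NeZero.ne _
  let τ : ℝ → ℂ := fun t ↦ (2 / N : ℝ) + I * t
  let σ : ℝ → ℂ := fun t ↦ I * t * N / (2 * τ t)
  let A : ℝ → ℂ := fun t ↦ ∑ a ∈ Finset.range N, exp (Real.pi * I * a ^ 2 * (2 / N : ℝ)) *
    jacobiTheta₂ (a / N : ℝ) (-1 / (N ^ 2 * (I * t)))
  let B : ℝ → ℂ := fun t ↦ ∑ a ∈ Finset.range 2, exp (Real.pi * I * a ^ 2 * (-N / 2 : ℝ)) *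
    jacobiTheta₂ (a / (2 : ℕ) : ℝ) (-1 / ((2 : ℕ) ^ 2 * σ t))
  have hτre (t : ℝ) : (τ t).re = 2 / N := by simp [τ, -ofReal_div]
  have hτim (t : ℝ) : (τ t).im = t := by simp [τ, -ofReal_div]
  have hτ0 (t : ℝ) : τ t ≠ 0 := fun h ↦ by
    have := hτre t
    rw [h, zero_re] at this
    exact (by positivity : 2 / (N : ℝ) ≠ 0) this.symm
  have hσ (t : ℝ) (ht : 0 < t) :
      -1 / ((2 : ℕ) ^ 2 * σ t) = (1 / (2 * N * t) : ℝ) * (τ t * I) := by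
    have := hτ0 t
    have ht' : (t : ℂ) ≠ 0 := ofReal_ne_zero.mpr ht.ne'
    simp only [σ]
    push_cast
    field_simp
    rw [I_sq]
  have hστ (t : ℝ) : -1 / τ t = (-N / 2 : ℝ) + σ t := by
    have := hτ0 t
    simp only [σ]
    field_simp
    simp only [τ]
    push_cast
    field_simp
    ring
  have hσim (t : ℝ) (ht : 0 < t) : 0 < (σ t).im := by
    have : (σ t).im = (-1 / τ t).im := by rw [hστ, add_im, ofReal_im, zero_add]
    rw [this, div_im]
    have := normSq_pos.mpr (hτ0 t)
    simp only [hτim, neg_re, neg_im, one_re, one_im]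
    rw [neg_zero, zero_mul, zero_div, zero_sub, neg_mul, one_mul, neg_div, neg_neg]
    positivity
  have hA (t : ℝ) (ht : 0 < t) :
      jacobiTheta (τ t) = 1 / (t * (N ^ 2 : ℂ)) ^ (1 / 2 : ℂ) * A t := by
    simp only [τ]
    rw [jacobiTheta_add_eq_sum (M := N) (fun n a ↦ ?_) (by simpa using ht)]
    · congr 3
      linear_combination (-(N : ℂ) ^ 2 * t) * I_sq
    · rw [exp_eq_exp_iff_exists_int]
      refine ⟨n ^ 2 * N + 2 * n * a, ?_⟩
      push_cast
      field_simp
      ring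
  have hB (t : ℝ) (ht : 0 < t) : jacobiTheta (τ t) = 1 / (-I * τ t) ^ (1 / 2 : ℂ) *
      (1 / (t * (2 * N / τ t)) ^ (1 / 2 : ℂ) * B t) := by
    rw [jacobiTheta_eq_jacobiTheta₂, jacobiTheta₂_functional_equation, zero_div,
      ← jacobiTheta_eq_jacobiTheta₂, hστ,
      jacobiTheta_add_eq_sum (M := 2) (fun n a ↦ ?_) (hσim t ht)]
    · have : -I * ((2 : ℕ) ^ 2 * σ t) = t * (2 * N / τ t) := by
        have := hτ0 t
        simp only [σ]
        push_cast
        field_simp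
        rw [I_sq]; ring
      rw [this]
      simp [B]
    · rw [exp_eq_exp_iff_exists_int]
      refine ⟨-(n ^ 2 * N + n * a * N), ?_⟩
      push_cast
      ring
  have hAB (t : ℝ) (ht : 0 < t) : A t / (N ^ 2 : ℂ) ^ (1 / 2 : ℂ) =
      B t / ((-I * τ t) ^ (1 / 2 : ℂ) * (2 * N / τ t) ^ (1 / 2 : ℂ)) := by
    have h := (hA t ht).symm.trans (hB t ht)
    rw [ofReal_mul_cpow ht (by simp [hN0]),
      ofReal_mul_cpow ht (div_ne_zero (by simp [hN0]) (hτ0 t))] at h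
    have ht' : (t : ℂ) ^ (1 / 2 : ℂ) ≠ 0 := by simp [cpow_eq_zero_iff, ht.ne']
    apply mul_left_cancel₀ (inv_ne_zero ht')
    simp only [div_eq_mul_inv, mul_inv, one_mul] at h ⊢
    linear_combination h
  have hinv : Filter.Tendsto (fun t : ℝ ↦ (1 / N ^ 2 : ℝ) * t⁻¹) (nhdsWithin 0 (Set.Ioi 0))
      Filter.atTop := tendsto_inv_nhdsGT_zero.const_mul_atTop (by positivity)
  have hAlim : Filter.Tendsto A (nhdsWithin 0 (Set.Ioi 0))
      (nhds (∑ a ∈ Finset.range N, exp (Real.pi * I * a ^ 2 * (2 / N : ℝ)) * 1)) := by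
    refine tendsto_finsetSum _ fun a _ ↦ (tendsto_jacobiTheta₂_ofReal ?_ _).const_mul _
    refine hinv.congr' (Filter.eventually_of_mem self_mem_nhdsWithin fun t (ht : 0 < t) ↦ ?_)
    have : -1 / (N ^ 2 * (I * t) : ℂ) = (1 / N ^ 2 * t⁻¹ : ℝ) * I := by
      have ht' : (t : ℂ) ≠ 0 := ofReal_ne_zero.mpr ht.ne'
      push_cast
      field_simp
      rw [I_sq]
    simp only
    rw [this, im_ofReal_mul, I_im, mul_one]
  have hBlim : Filter.Tendsto B (nhdsWithin 0 (Set.Ioi 0))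
      (nhds (∑ a ∈ Finset.range 2, exp (Real.pi * I * a ^ 2 * (-N / 2 : ℝ)) * 1)) := by
    refine tendsto_finsetSum _ fun a _ ↦ (tendsto_jacobiTheta₂_ofReal ?_ _).const_mul _
    refine hinv.congr' (Filter.eventually_of_mem self_mem_nhdsWithin fun t (ht : 0 < t) ↦ ?_)
    simp only
    rw [hσ t ht, im_ofReal_mul, mul_I_im, hτre]
    field_simp
  have hτlim : Filter.Tendsto τ (nhdsWithin 0 (Set.Ioi 0)) (nhds (τ 0)) :=
    (Continuous.tendsto (by fun_prop) 0).mono_left nhdsWithin_le_nhds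
  have hτ0eq : τ 0 = 2 / N := by simp [τ]
  have hsq : Real.sqrt N ≠ 0 := (Real.sqrt_pos.mpr hN).ne'
  have hsq0 : (Real.sqrt N : ℂ) ≠ 0 := ofReal_ne_zero.mpr hsq
  have hsq2 : (Real.sqrt N : ℂ) ^ 2 = N := by
    rw [← ofReal_pow, Real.sq_sqrt hN.le, ofReal_natCast]
  have hval₁ : (-I * τ 0) ^ (1 / 2 : ℂ) = (1 - I) / Real.sqrt N := by
    have : -I * τ 0 = ((1 - I) / Real.sqrt N) ^ 2 := by
      rw [hτ0eq, div_pow, hsq2]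
      field_simp
      linear_combination -I_sq
    rw [this, one_div, sq_cpow_two_inv]
    rw [div_ofReal_re]
    simp only [sub_re, one_re, I_re, sub_zero]
    positivity
  have hval₂ : ((N : ℂ) ^ 2) ^ (1 / 2 : ℂ) = N := by
    rw [one_div, sq_cpow_two_inv (by simpa using hN)]
  have hτN : 2 * N / τ 0 = (N : ℂ) ^ 2 := by rw [hτ0eq]; field_simp
  have hden : Filter.Tendsto (fun t ↦ (-I * τ t) ^ (1 / 2 : ℂ) * (2 * N / τ t) ^ (1 / 2 : ℂ))
      (nhdsWithin 0 (Set.Ioi 0)) (nhds ((1 - I) / Real.sqrt N * N)) := by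
    rw [← hval₁]
    nth_rewrite 2 [← hval₂]
    rw [← hτN]
    refine ((hτlim.const_mul _).cpow tendsto_const_nhds ?_).mul
      ((tendsto_const_nhds.div hτlim (hτ0 0)).cpow tendsto_const_nhds ?_)
    · right
      simpa [hτ0eq] using NeZero.ne N
    · left
      rw [hτN, ← ofReal_natCast, ← ofReal_pow, ofReal_re]
      positivity
  have h1I : (1 - I : ℂ) ≠ 0 := fun h ↦ by simpa using congrArg re h
  have hAB' := Filter.eventually_of_mem (self_mem_nhdsWithin (a := (0 : ℝ)) (s := Set.Ioi 0)) hAB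
  have hlim := tendsto_nhds_unique ((hAlim.div_const _).congr' hAB')
    (hBlim.div hden (by simp [hsq0, hN0, h1I]))
  rw [hval₂] at hlim
  have hG : ∑ n ∈ Finset.range N, exp (2 * Real.pi * I * n ^ 2 / N) =
      ∑ a ∈ Finset.range N, exp (Real.pi * I * a ^ 2 * (2 / N : ℝ)) * 1 :=
    Finset.sum_congr rfl fun a _ ↦ by rw [mul_one]; push_cast; congr 1; ring
  have hexp : exp (Real.pi * I * (-N / 2)) = (-I) ^ N := by
    rw [← exp_neg_pi_div_two_mul_I, ← exp_nat_mul]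
    congr 1
    ring
  rw [← hG] at hlim
  simp only [Finset.sum_range_succ, Finset.sum_range_zero] at hlim
  push_cast at hlim
  simp only [one_pow, mul_one, hexp, zero_add, ne_eq, OfNat.ofNat_ne_zero, not_false_eq_true,
    zero_pow, mul_zero, zero_mul, Complex.exp_zero] at hlim
  generalize ∑ n ∈ Finset.range N, exp (2 * Real.pi * I * n ^ 2 / N) = S at hlim ⊢
  field_simp at hlim ⊢
  linear_combination (1 + I) * hlim + S * I_sq

lemma sum_addChar_sq {F : Type*} [Field F] [Fintype F] [DecidableEq F] (hF : ringChar F ≠ 2)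
    {ψ : AddChar F ℂ} (hψ : ψ ≠ 1) :
    ∑ x, ψ (x ^ 2) = gaussSum ((quadraticChar F).ringHomComp (Int.castRingHom ℂ)) ψ := by
  have h (y : F) : ∑ x with x ^ 2 = y, ψ (x ^ 2) = ((quadraticChar F y : ℂ) + 1) * ψ y := by
    rw [Finset.sum_congr rfl (g := fun _ ↦ ψ y) (by simp +contextual), Finset.sum_const,
      nsmul_eq_mul]
    congr 1
    have := quadraticChar_card_sqrts hF y
    rw [Set.toFinset_ofPred] at this
    exact_mod_cast this
  rw [← Finset.sum_fiberwise (g := fun x : F ↦ x ^ 2)]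
  simp only [h, add_mul, one_mul, Finset.sum_add_distrib, AddChar.sum_eq_zero_of_ne_one hψ,
    add_zero, gaussSum, MulChar.ringHomComp_apply, eq_intCast]

lemma sum_addChar_mul_sq {F : Type*} [Field F] [Fintype F] [DecidableEq F] (hF : ringChar F ≠ 2)
    {ψ : AddChar F ℂ} (hψ : ψ.IsPrimitive) {c : F} (hc : c ≠ 0) :
    ∑ x, ψ (c * x ^ 2) = quadraticChar F c * ∑ x, ψ (x ^ 2) := by
  have h1 : ψ ≠ 1 := by simpa using hψ one_ne_zero
  have h := sum_addChar_sq hF (hψ hc)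
  simp only [AddChar.mulShift_apply] at h
  have hg := gaussSum_mulShift ((quadraticChar F).ringHomComp (Int.castRingHom ℂ)) ψ
    (Units.mk0 c hc)
  rw [Units.val_mk0, MulChar.ringHomComp_apply, eq_intCast] at hg
  have hsq : (quadraticChar F c : ℂ) ^ 2 = 1 := by exact_mod_cast quadraticChar_sq_one hc
  rw [h, sum_addChar_sq hF h1, ← hg, ← mul_assoc, ← sq, hsq, one_mul]

lemma sum_range_natCast_zmod {M : Type*} [AddCommMonoid M] (N : ℕ) [NeZero N] (f : ZMod N → M) :
    ∑ n ∈ Finset.range N, f n = ∑ x, f x :=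
  Finset.sum_bij' (fun n _ ↦ (n : ZMod N)) (fun x _ ↦ x.val) (by simp)
    (by simp [ZMod.val_lt]) (fun n hn ↦ ZMod.val_cast_of_lt (Finset.mem_range.mp hn)) (by simp)
    (by simp)

lemma one_add_neg_I_pow_of_odd {N : ℕ} (hN : Odd N) :
    (1 + I) / 2 * (1 + (-I) ^ N) = if N % 4 = 1 then 1 else I := by
  have h4 : (-I) ^ 4 = 1 := by rw [neg_pow, I_pow_four]; norm_num
  rw [← Nat.div_add_mod N 4, pow_add, pow_mul, h4, one_pow, one_mul]
  have : N % 4 = 1 ∨ N % 4 = 3 := by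
    have := Nat.odd_iff.mp hN
    omega
  rcases this with h | h <;> rw [h]
  · rw [if_pos (by omega)]
    linear_combination (-1 / 2) * I_sq
  · rw [if_neg (by omega)]
    linear_combination ((1 - I - I ^ 2) / 2) * I_sq

/-- Closed-form expression for the sum of one period of a Zadoff–Chu sequence of odd
prime length (the zero-frequency DFT coefficient). -/
theorem zc_dft_zero (N : ℕ) [Fact N.Prime] (hodd : Odd N) (u : ℤ)
    (hu1 : 1 ≤ u) (hu2 : u ≤ (N : ℤ) - 1)
    (η : ℂ) (hη : η = if N % 4 = 1 then 1 else -Complex.I)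
    (α : ℤ) (hα : α = ((N : ℤ) + 1) / 2) :
    (∑ n ∈ Finset.range N,
        Complex.exp (-((Real.pi : ℂ) * u * (n : ℂ) * ((n : ℂ) + 1) / N) * Complex.I))
      = (legendreSym N (2 * u) : ℂ) * η * (Real.sqrt N : ℂ)
        * Complex.exp (2 * (Real.pi : ℂ) * Complex.I * u * (α : ℂ) ^ 3 / N) := by
  
  have : NeZero N := ⟨(Fact.out : N.Prime).ne_zero⟩
  have hN2 : N ≠ 2 := by rintro rfl; exact absurd hodd (by decide)
  have hF : ringChar (ZMod N) ≠ 2 := by rwa [ZMod.ringChar_zmod_n]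
  have h2α : 2 * α = N + 1 := by
    obtain ⟨k, hk⟩ := hodd
    subst hk
    push_cast at hα ⊢
    omega
  have h2α' : (2 * α : ZMod N) = 1 := by
    have := congrArg (Int.cast : ℤ → ZMod N) h2α
    simpa using this
  have hα0 : (α : ZMod N) ≠ 0 := right_ne_zero_of_mul (h2α' ▸ one_ne_zero)
  have hu0 : (u : ZMod N) ≠ 0 := by
    rw [Ne, ZMod.intCast_zmod_eq_zero_iff_dvd]
    intro h
    have := Int.le_of_dvd (by omega) h
    omega
  have hterm (n : ℕ) : exp (-((Real.pi : ℂ) * u * (n : ℂ) * ((n : ℂ) + 1) / N) * I) =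
      ZMod.stdAddChar (-(u * α : ZMod N) * ((n : ZMod N) + (α : ZMod N)) ^ 2) *
        exp (2 * (Real.pi : ℂ) * I * u * (α : ℂ) ^ 3 / N) := by
    obtain ⟨k, hk⟩ : ∃ k : ℤ, (n : ℤ) * (n + 1) = 2 * k := (Int.even_mul_succ_self n).two_dvd
    have hkC : (n : ℂ) * (n + 1) = 2 * k := by exact_mod_cast hk
    have hkZ : (n : ZMod N) * (n + 1) = 2 * k := by
      exact_mod_cast congrArg (Int.cast : ℤ → ZMod N) hk
    have hl : exp (-((Real.pi : ℂ) * u * (n : ℂ) * ((n : ℂ) + 1) / N) * I) =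
        ZMod.stdAddChar ((-(u * k) : ℤ) : ZMod N) := by
      rw [ZMod.stdAddChar_coe]
      congr 1
      push_cast
      linear_combination (-Real.pi * u * I / N) * hkC
    have hr : exp (2 * (Real.pi : ℂ) * I * u * (α : ℂ) ^ 3 / N) =
        ZMod.stdAddChar ((u * α ^ 3 : ℤ) : ZMod N) := by
      rw [ZMod.stdAddChar_coe]
      congr 1
      push_cast
      ring
    rw [hl, hr, ← AddChar.map_add_eq_mul]
    congr 1
    push_cast
    linear_combination (u * k + u * α * n : ZMod N) * h2α' + u * α * hkZ
  have hG : ∑ x : ZMod N, (ZMod.stdAddChar (x ^ 2) : ℂ) =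
      (if N % 4 = 1 then 1 else I) * Real.sqrt N := by
    rw [← one_add_neg_I_pow_of_odd hodd, ← sum_exp_sq_div, ← sum_range_natCast_zmod]
    refine Finset.sum_congr rfl fun n _ ↦ ?_
    have := ZMod.stdAddChar_coe (N := N) (n ^ 2)
    push_cast at this
    exact this
  have hχ : (quadraticChar (ZMod N) (-(u * α : ZMod N)) : ℂ) =
      legendreSym N (2 * u) * if N % 4 = 1 then 1 else -1 := by
    have h1 : (-(u * α) : ZMod N) = ((2 * u : ℤ) : ZMod N) * (-1) * α ^ 2 := by
      push_cast
      linear_combination (u * α : ZMod N) * h2α'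
    rw [h1, map_mul, map_mul, quadraticChar_sq_one' hα0, mul_one, quadraticChar_neg_one hF,
      ZMod.card, ZMod.χ₄_nat_eq_if_mod_four, legendreSym,
      if_neg (by have := Nat.odd_iff.mp hodd; omega)]
    push_cast
    rfl
  have hshift : ∑ x : ZMod N, (ZMod.stdAddChar (-(u * α : ZMod N) * (x + (α : ZMod N)) ^ 2) : ℂ) =
      ∑ x : ZMod N, (ZMod.stdAddChar (-(u * α : ZMod N) * x ^ 2) : ℂ) :=
    Equiv.sum_comp (Equiv.addRight (α : ZMod N)) fun x ↦ ZMod.stdAddChar (-(u * α : ZMod N) * x ^ 2)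
  simp only [hterm]
  rw [← Finset.sum_mul,
    sum_range_natCast_zmod N fun x ↦
      (ZMod.stdAddChar (-(u * α : ZMod N) * (x + (α : ZMod N)) ^ 2) : ℂ),
    hshift,
    sum_addChar_mul_sq hF (ZMod.isPrimitive_stdAddChar N) (neg_ne_zero.mpr (mul_ne_zero hu0 hα0)),
    hG, hχ, hη]
  split_ifs <;> ring
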